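/- For every t ∈ (0,1), the derivative of the interpolated quenched free energy satisfies the exact identity obtained by Gaussian integration by parts: d/dt (1/|Λ|) E[ln Z_Λ(t)] = (β²/(4|Λ|)) E[ Σ_n (1/M) Σ_{i,j∈Ω_n} ⟨σ_i σ_j⟩_t² − Σ_{i,j∈Λ} (w(i−j;γ)/W(γ)) ⟨σ_i σ_j⟩_t² ] + (β²/4) ( (1/|Λ|) Σ_{i,j∈Λ} w(i−j;γ)/W(γ) − 1 ), where ⟨·⟩_t is the Gibbs average associated with the interpolating Boltzmann weights. -/

import Mathlib

open MeasureTheory ProbabilityTheory Filter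

noncomputable section

/-- The spin value `±1` attached to a Boolean. -/
def spinVal (b : Bool) : ℝ := if b then 1 else -1

/-- The joint law of a family of i.i.d. standard Gaussian couplings indexed by `ι`. -/
def gaussians (ι : Type*) [Fintype ι] : Measure (ι → ℝ) :=
  Measure.pi fun _ => gaussianReal 0 1

/-- The Kac potential `w(r;γ) = γ^d φ(γ r)`. -/
def kacw (d : ℕ) (φ : (Fin d → ℝ) → ℝ) (γ : ℝ) (r : Fin d → ℤ) : ℝ :=
  γ ^ d * φ fun α => γ * (r α : ℝ)

/-- The normalization `W(γ) = Σ_{i ∈ ℤ^d} w(i;γ)`. -/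
def kacW (d : ℕ) (φ : (Fin d → ℝ) → ℝ) (γ : ℝ) : ℝ :=
  ∑' r : Fin d → ℤ, kacw d φ γ r

/-- A site of the hypercube `Λ ⊂ ℤ^d` of side `L = K·ℓ`, addressed as a pair
`(n, r)`: `n` labels the sub-cube `Ω_n` of side `ℓ` and `r` the offset inside it. -/
abbrev Site (d K ℓ : ℕ) := (Fin d → Fin K) × (Fin d → Fin ℓ)

/-- The position in `ℤ^d` of the site `(n, r)` of `Λ`. -/
def sitePos {d K ℓ : ℕ} (p : Site d K ℓ) : Fin d → ℤ :=
  fun α => (p.1 α : ℤ) * ℓ + (p.2 α : ℤ)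

/-- The interpolating Boltzmann weight at interpolation parameter `t`:
`exp( β√(1−t) Σ_n Σ_{i,j∈Ω_n} J_{ij}σ_iσ_j/√(2M) + β√t Σ_{i,j∈Λ} √(w(i−j;γ)/(2W(γ))) J'_{ij}σ_iσ_j + βh Σ_i σ_i )`,
where `M = ℓ^d`. -/
def interpWeight (d K ℓ : ℕ) (φ : (Fin d → ℝ) → ℝ) (γ β h t : ℝ)
    (J J' : Site d K ℓ × Site d K ℓ → ℝ) (σ : Site d K ℓ → Bool) : ℝ :=
  Real.exp (
    β * Real.sqrt (1 - t) / Real.sqrt (2 * (ℓ ^ d : ℝ)) *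
      ∑ n : Fin d → Fin K, ∑ r : Fin d → Fin ℓ, ∑ s : Fin d → Fin ℓ,
        J ((n, r), (n, s)) * spinVal (σ (n, r)) * spinVal (σ (n, s))
    + β * Real.sqrt t *
      ∑ p : Site d K ℓ, ∑ q : Site d K ℓ,
        Real.sqrt (kacw d φ γ (fun α => sitePos p α - sitePos q α) / (2 * kacW d φ γ)) *
          J' (p, q) * spinVal (σ p) * spinVal (σ q)
    + β * h * ∑ p : Site d K ℓ, spinVal (σ p))

/-- The interpolating partition function `Z_Λ(t)`. -/
def interpZ (d K ℓ : ℕ) (φ : (Fin d → ℝ) → ℝ) (γ β h t : ℝ)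
    (J J' : Site d K ℓ × Site d K ℓ → ℝ) : ℝ :=
  ∑ σ : Site d K ℓ → Bool, interpWeight d K ℓ φ γ β h t J J' σ

/-- The quenched average `E[ln Z_Λ(t)]`, over the two independent families of
i.i.d. standard Gaussian couplings `J` and `J'`. -/
def interpQuenched (d K ℓ : ℕ) (φ : (Fin d → ℝ) → ℝ) (γ β h t : ℝ) : ℝ :=
  ∫ c : (Site d K ℓ × Site d K ℓ) ⊕ (Site d K ℓ × Site d K ℓ) → ℝ,
    Real.log (interpZ d K ℓ φ γ β h t
      (fun pq => c (Sum.inl pq)) (fun pq => c (Sum.inr pq)))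
    ∂ gaussians ((Site d K ℓ × Site d K ℓ) ⊕ (Site d K ℓ × Site d K ℓ))

/-- The Gibbs average `⟨f⟩_t` associated with the interpolating Boltzmann weights,
for a fixed realization of the disorder. -/
def gibbs (d K ℓ : ℕ) (φ : (Fin d → ℝ) → ℝ) (γ β h t : ℝ)
    (J J' : Site d K ℓ × Site d K ℓ → ℝ) (f : (Site d K ℓ → Bool) → ℝ) : ℝ :=
  (∑ σ : Site d K ℓ → Bool, f σ * interpWeight d K ℓ φ γ β h t J J' σ) /
    interpZ d K ℓ φ γ β h t J J'

/-- The two-replica Gibbs average `⟨f(σ¹,σ²)⟩_t`: the two replicas are independent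
spin configurations sharing the same disorder. -/
def gibbs2 (d K ℓ : ℕ) (φ : (Fin d → ℝ) → ℝ) (γ β h t : ℝ)
    (J J' : Site d K ℓ × Site d K ℓ → ℝ)
    (f : (Site d K ℓ → Bool) → (Site d K ℓ → Bool) → ℝ) : ℝ :=
  (∑ σ₁ : Site d K ℓ → Bool, ∑ σ₂ : Site d K ℓ → Bool,
      f σ₁ σ₂ * interpWeight d K ℓ φ γ β h t J J' σ₁ *
        interpWeight d K ℓ φ γ β h t J J' σ₂) /
    (interpZ d K ℓ φ γ β h t J J') ^ 2

/-- The partial overlap `q^{(n)}_{12} = (1/M) Σ_{i∈Ω_n} σ¹_i σ²_i` of two replicas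
in the sub-cube `Ω_n`, with `M = ℓ^d`. -/
def overlap (d K ℓ : ℕ) (n : Fin d → Fin K) (σ₁ σ₂ : Site d K ℓ → Bool) : ℝ :=
  (1 / (ℓ ^ d : ℝ)) * ∑ r : Fin d → Fin ℓ, spinVal (σ₁ (n, r)) * spinVal (σ₂ (n, r))

/-! ### General lemmas -/

/-- One-dimensional Gaussian integration by parts. -/
lemma stein_one (g g' : ℝ → ℝ) (C C' : ℝ) (hg : ∀ x, HasDerivAt g (g' x) x)
    (hb : ∀ x, |g x| ≤ C) (hb' : ∀ x, |g' x| ≤ C') :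
    ∫ x, x * g x ∂(gaussianReal 0 1) = ∫ x, g' x ∂(gaussianReal 0 1) := by
  have hgc : Continuous g := continuous_iff_continuousAt.2 fun x => (hg x).continuousAt
  have hg'm : Measurable g' := by
    have : g' = deriv g := funext fun x => (hg x).deriv.symm
    rw [this]; exact measurable_deriv g
  have hp : Integrable (gaussianPDFReal 0 1) := integrable_gaussianPDFReal 0 1
  have hpd : ∀ x, HasDerivAt (gaussianPDFReal 0 1) (-x * gaussianPDFReal 0 1 x) x := by
    intro x
    rw [gaussianPDFReal_def]
    have h1 : HasDerivAt (fun x : ℝ => -(x - 0) ^ 2 / (2 * ((1 : NNReal) : ℝ))) (-x) x := by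
      have := ((((hasDerivAt_id x).sub_const 0).pow 2).neg).div_const (2 * ((1 : NNReal) : ℝ))
      convert! this using 1
      simp
      ring
    have := (h1.exp).const_mul ((√(2 * Real.pi * ((1 : NNReal) : ℝ)))⁻¹)
    convert! this using 1
    ring
  have hxp : Integrable (fun x => x * gaussianPDFReal 0 1 x) := by
    have h0 : Integrable (fun x : ℝ => x) (gaussianReal 0 1) :=
      (memLp_id_gaussianReal 1).integrable (by norm_num)
    rw [gaussianReal_of_var_ne_zero 0 (by norm_num)] at h0
    rw [integrable_withDensity_iff (measurable_gaussianPDF 0 1)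
      (ae_of_all _ fun x => gaussianPDF_lt_top)] at h0
    simpa [toReal_gaussianPDF] using h0
  rw [integral_gaussianReal_eq_integral_smul (by norm_num),
    integral_gaussianReal_eq_integral_smul (by norm_num)]
  have key := integral_mul_deriv_eq_deriv_mul_of_integrable (u := g)
    (v := gaussianPDFReal 0 1) (u' := g') (v' := fun x => -x * gaussianPDFReal 0 1 x)
    (fun x _ => hg x) (fun x _ => hpd x) ?_ ?_ ?_
  · have e1 : (fun x => gaussianPDFReal 0 1 x • (x * g x)) =
        fun x => -(g x * (-x * gaussianPDFReal 0 1 x)) := by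
      funext x; simp only [smul_eq_mul]; ring
    rw [e1, integral_neg, key, neg_neg]
    congr 1; funext x; simp only [smul_eq_mul]; ring
  · have := hxp.neg.bdd_mul (f := g) (c := C) hgc.aestronglyMeasurable (ae_of_all _ hb)
    refine this.congr (ae_of_all _ fun x => ?_)
    simp
  · exact hp.bdd_mul (f := g') (c := C') hg'm.aestronglyMeasurable (ae_of_all _ hb')
  · exact hp.bdd_mul (f := g) (c := C) hgc.aestronglyMeasurable (ae_of_all _ hb)

instance gaussians_prob (ι : Type*) [Fintype ι] : IsProbabilityMeasure (gaussians ι) := by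
  unfold gaussians; infer_instance

/-- Resampling one coordinate preserves the product law. -/
lemma gaussians_update {ι : Type*} [Fintype ι] [DecidableEq ι] (k : ι) :
    MeasurePreserving (fun p : (ι → ℝ) × ℝ => Function.update p.1 k p.2)
      ((gaussians ι).prod (gaussianReal 0 1)) (gaussians ι) := by
  have hm : Measurable (fun p : (ι → ℝ) × ℝ => Function.update p.1 k p.2) := by
    rw [measurable_pi_iff]
    intro j
    by_cases h : j = k
    · subst h; simpa using measurable_snd
    · simp only [Function.update_of_ne h]; fun_prop
  refine ⟨hm, ?_⟩
  conv_rhs => unfold gaussians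
  symm
  refine Measure.pi_eq fun s hs => ?_
  rw [Measure.map_apply hm (MeasurableSet.univ_pi hs)]
  have : (fun p : (ι → ℝ) × ℝ => Function.update p.1 k p.2) ⁻¹' Set.univ.pi s =
      (Set.univ.pi (Function.update s k Set.univ)) ×ˢ s k := by
    ext ⟨c, x⟩
    simp only [Set.mem_preimage, Set.mem_pi, Set.mem_univ, true_implies, Set.mem_prod]
    constructor
    · intro H
      refine ⟨fun j => ?_, by simpa using H k⟩
      by_cases h : j = k
      · subst h; simp
      · simpa [h] using H j
    · rintro ⟨H, hx⟩ j
      by_cases h : j = k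
      · subst h; simpa using hx
      · simpa [h] using H j
  rw [this, Measure.prod_prod, gaussians, Measure.pi_pi,
    ← Finset.prod_erase_mul _ _ (Finset.mem_univ k),
    ← Finset.prod_erase_mul (Finset.univ) (fun i => gaussianReal 0 1 (s i)) (Finset.mem_univ k)]
  simp only [Function.update_self, measure_univ, mul_one]
  congr 1
  refine Finset.prod_congr rfl fun j hj => ?_
  rw [Function.update_of_ne (Finset.ne_of_mem_erase hj)]

lemma gaussians_eval {ι : Type*} [Fintype ι] (k : ι) :
    Integrable (fun c : ι → ℝ => c k) (gaussians ι) := by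
  have h0 : Integrable (fun x : ℝ => x) (gaussianReal 0 1) :=
    (memLp_id_gaussianReal 1).integrable (by norm_num)
  exact (measurePreserving_eval (fun _ : ι => gaussianReal 0 1) k).integrable_comp_of_integrable h0

/-- Gaussian integration by parts in one coordinate of an i.i.d. Gaussian family. -/
lemma stein_pi {ι : Type*} [Fintype ι] [DecidableEq ι] (k : ι) (G G' : (ι → ℝ) → ℝ) (C C' : ℝ)
    (hGm : Measurable G) (hGm' : Measurable G')
    (hG : ∀ c x, HasDerivAt (fun y => G (Function.update c k y)) (G' (Function.update c k x)) x)
    (hb : ∀ c, |G c| ≤ C) (hb' : ∀ c, |G' c| ≤ C') :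
    ∫ c, c k * G c ∂(gaussians ι) = ∫ c, G' c ∂(gaussians ι) := by
  have hmp := gaussians_update k
  have i1 : Integrable (fun c => c k * G c) (gaussians ι) :=
    (gaussians_eval k).mul_bdd (c := C) hGm.aestronglyMeasurable (ae_of_all _ hb)
  have i2 : Integrable G' (gaussians ι) :=
    Integrable.of_bound hGm'.aestronglyMeasurable C' (ae_of_all _ hb')
  have e : ∀ f : (ι → ℝ) → ℝ, Integrable f (gaussians ι) → ∫ c, f c ∂(gaussians ι) =
      ∫ c, ∫ x, f (Function.update c k x) ∂(gaussianReal 0 1) ∂(gaussians ι) := by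
    intro f hf
    rw [← integral_prod (f := fun p : (ι → ℝ) × ℝ => f (Function.update p.1 k p.2))
      (hmp.integrable_comp_of_integrable hf)]
    conv_lhs => rw [← hmp.map_eq]
    rw [integral_map hmp.measurable.aemeasurable]
    rw [hmp.map_eq]; exact hf.aestronglyMeasurable
  rw [e _ i1, e _ i2]
  congr 1; funext c
  simp only [Function.update_self]
  exact stein_one _ _ C C' (fun x => hG c x) (fun x => hb _) (fun x => hb' _)

section gibbsGeneral
set_option linter.unusedSectionVars false
variable {S : Type*} [Fintype S] [Nonempty S]

/-- Gibbs average with energies `E`. -/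
def gav (E : S → ℝ) (f : S → ℝ) : ℝ := (∑ σ, f σ * Real.exp (E σ)) / ∑ σ, Real.exp (E σ)

lemma gz_pos (E : S → ℝ) : 0 < ∑ σ, Real.exp (E σ) :=
  Finset.sum_pos (fun _ _ => Real.exp_pos _) Finset.univ_nonempty

lemma gav_abs_le (E f : S → ℝ) (C : ℝ) (hf : ∀ σ, |f σ| ≤ C) : |gav E f| ≤ C := by
  unfold gav
  rw [abs_div, abs_of_pos (gz_pos E), div_le_iff₀ (gz_pos E), Finset.mul_sum]
  refine (Finset.abs_sum_le_sum_abs _ _).trans (Finset.sum_le_sum fun σ _ => ?_)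
  rw [abs_mul, abs_of_pos (Real.exp_pos _)]
  exact mul_le_mul_of_nonneg_right (hf σ) (Real.exp_pos _).le

lemma gav_const (E : S → ℝ) (C : ℝ) : gav E (fun _ => C) = C := by
  unfold gav
  rw [← Finset.mul_sum, mul_div_assoc, div_self (gz_pos E).ne', mul_one]

lemma gav_mul_left (E f : S → ℝ) (C : ℝ) : gav E (fun σ => C * f σ) = C * gav E f := by
  unfold gav
  simp_rw [mul_assoc]
  rw [← Finset.mul_sum, mul_div_assoc]

lemma gav_sum {ι : Type*} [Fintype ι] (E : S → ℝ) (f : ι → S → ℝ) :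
    gav E (fun σ => ∑ k, f k σ) = ∑ k, gav E (f k) := by
  unfold gav
  rw [← Finset.sum_div]
  congr 1
  simp_rw [Finset.sum_mul]
  rw [Finset.sum_comm]

lemma gav_hasDerivAt (E : ℝ → S → ℝ) (E' f : S → ℝ) (x : ℝ)
    (hE : ∀ σ, HasDerivAt (fun u => E u σ) (E' σ) x) :
    HasDerivAt (fun u => gav (E u) f)
      (gav (E x) (fun σ => f σ * E' σ) - gav (E x) f * gav (E x) E') x := by
  unfold gav
  have h1 : HasDerivAt (fun u => ∑ σ, f σ * Real.exp (E u σ))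
      (∑ σ, f σ * (Real.exp (E x σ) * E' σ)) x :=
    HasDerivAt.fun_sum fun σ _ => ((hE σ).exp).const_mul _
  have h2 : HasDerivAt (fun u => ∑ σ, Real.exp (E u σ))
      (∑ σ, (Real.exp (E x σ) * E' σ)) x :=
    HasDerivAt.fun_sum fun σ _ => ((hE σ).exp)
  have hz := (gz_pos (E x)).ne'
  convert! h1.div h2 hz using 1
  have e1 : ∑ σ, f σ * E' σ * Real.exp (E x σ) = ∑ σ, f σ * (Real.exp (E x σ) * E' σ) :=
    Finset.sum_congr rfl fun σ _ => by ring
  have e2 : ∑ σ, E' σ * Real.exp (E x σ) = ∑ σ, (Real.exp (E x σ) * E' σ) :=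
    Finset.sum_congr rfl fun σ _ => by ring
  rw [e1, e2]
  field_simp

lemma log_hasDerivAt (E : ℝ → S → ℝ) (E' : S → ℝ) (x : ℝ)
    (hE : ∀ σ, HasDerivAt (fun u => E u σ) (E' σ) x) :
    HasDerivAt (fun u => Real.log (∑ σ, Real.exp (E u σ))) (gav (E x) E') x := by
  have h2 : HasDerivAt (fun u => ∑ σ, Real.exp (E u σ))
      (∑ σ, (Real.exp (E x σ) * E' σ)) x :=
    HasDerivAt.fun_sum fun σ _ => ((hE σ).exp)
  convert! h2.log (gz_pos (E x)).ne' using 1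
  unfold gav
  congr 1
  exact Finset.sum_congr rfl fun σ _ => by ring

lemma log_abs_le (E : S → ℝ) (B : ℝ) (hE : ∀ σ, |E σ| ≤ B) :
    |Real.log (∑ σ, Real.exp (E σ))| ≤ Real.log (Fintype.card S) + B := by
  have hc : (1 : ℝ) ≤ Fintype.card S := by exact_mod_cast Fintype.card_pos
  rw [abs_le]
  constructor
  · obtain ⟨σ⟩ := (inferInstance : Nonempty S)
    have h1 : Real.exp (-B) ≤ ∑ σ, Real.exp (E σ) :=
      (Real.exp_le_exp.2 (abs_le.1 (hE σ)).1).trans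
        (Finset.single_le_sum (f := fun σ => Real.exp (E σ)) (fun _ _ => (Real.exp_pos _).le)
          (Finset.mem_univ σ))
    have h2 := Real.log_le_log (Real.exp_pos _) h1
    rw [Real.log_exp] at h2
    have := Real.log_nonneg hc
    linarith
  · have h1 : ∑ σ, Real.exp (E σ) ≤ Fintype.card S * Real.exp B := by
      refine (Finset.sum_le_sum fun σ _ => Real.exp_le_exp.2 (abs_le.1 (hE σ)).2).trans ?_
      simp
    have h2 := Real.log_le_log (gz_pos E) h1
    rwa [Real.log_mul (by positivity) (Real.exp_pos _).ne', Real.log_exp] at h2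

/-- Linear Gaussian Hamiltonian. -/
def gH {ι : Type*} [Fintype ι] (a : ι → ℝ) (s : ι → S → ℝ) (b : S → ℝ) (c : ι → ℝ) (σ : S) : ℝ :=
  ∑ k, a k * c k * s k σ + b σ

lemma gav_measurable {ι : Type*} [Fintype ι] (a : ι → ℝ) (s : ι → S → ℝ) (b f : S → ℝ) :
    Measurable fun c => gav (gH a s b c) f := by
  unfold gav gH
  fun_prop

open scoped Topology in
/-- General interpolation formula. -/
lemma general_deriv {ι : Type*} [Fintype ι] [DecidableEq ι] (a a' : ι → ℝ → ℝ) (s : ι → S → ℝ)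
    (hs : ∀ k σ, s k σ ^ 2 = 1) (b : S → ℝ) (t : ℝ)
    (ha : ∀ k, ∀ᶠ u in 𝓝 t, HasDerivAt (a k) (a' k u) u)
    (ha' : ∀ k, ContinuousAt (a' k) t) :
    HasDerivAt (fun u => ∫ c, Real.log (∑ σ, Real.exp (gH (fun k => a k u) s b c σ)) ∂(gaussians ι))
      (∑ k, a' k t * a k t * (1 - ∫ c, gav (gH (fun k => a k t) s b c) (s k) ^ 2 ∂(gaussians ι)))
      t := by
  have hs1 : ∀ k σ, |s k σ| ≤ 1 := fun k σ => by
    rw [← sq_le_one_iff_abs_le_one, hs]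
  have hU : ∀ᶠ u in 𝓝 t, ∀ k, HasDerivAt (a k) (a' k u) u ∧ |a' k u| < |a' k t| + 1 := by
    rw [eventually_all]
    intro k
    exact (ha k).and ((ha' k).abs.eventually (gt_mem_nhds (by linarith)))
  set F' : ℝ → (ι → ℝ) → ℝ := fun u c =>
    gav (gH (fun k => a k u) s b c) (fun σ => ∑ k, a' k u * c k * s k σ) with hF'
  have hF'eq : ∀ u c, F' u c = ∑ k, a' k u * (c k * gav (gH (fun k => a k u) s b c) (s k)) := by
    intro u c
    simp only [hF', gav_sum, gav_mul_left]
    exact Finset.sum_congr rfl fun k _ => by ring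
  have hgm := fun k => gav_measurable (fun k => a k t) s b (s k)
  have hlog : ∀ u, Measurable fun c : ι → ℝ =>
      Real.log (∑ σ, Real.exp (gH (fun k => a k u) s b c σ)) := by
    intro u; unfold gH; fun_prop
  have main := hasDerivAt_integral_of_dominated_loc_of_deriv_le (μ := gaussians ι) (x₀ := t)
    (F := fun u c => Real.log (∑ σ, Real.exp (gH (fun k => a k u) s b c σ)))
    (F' := F') (bound := fun c => ∑ k, (|a' k t| + 1) * |c k|) hU
    (Eventually.of_forall fun u => (hlog u).aestronglyMeasurable) ?_ ?_ ?_ ?_ ?_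
  · refine main.2.congr_deriv ?_
    symm
    rw [integral_congr_ae (ae_of_all _ (hF'eq t))]
    have hi : ∀ k, Integrable (fun c => c k * gav (gH (fun k => a k t) s b c) (s k))
        (gaussians ι) := fun k =>
      (gaussians_eval k).mul_bdd (c := 1) (hgm k).aestronglyMeasurable
        (ae_of_all _ fun c => gav_abs_le _ _ _ (hs1 k))
    rw [integral_finsetSum _ fun k _ => (hi k).const_mul _]
    refine Finset.sum_congr rfl fun k _ => ?_
    rw [integral_const_mul, mul_assoc]
    congr 1
    have hsq : ∀ c, |gav (gH (fun k => a k t) s b c) (s k) ^ 2| ≤ 1 := fun c => by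
      rw [abs_pow]
      exact pow_le_one₀ (abs_nonneg _) (gav_abs_le _ _ _ (hs1 k))
    rw [stein_pi k (fun c => gav (gH (fun k => a k t) s b c) (s k))
      (fun c => a k t * (1 - gav (gH (fun k => a k t) s b c) (s k) ^ 2)) 1 (|a k t| * 2)
      (hgm k) (((hgm k).pow_const 2).const_sub 1 |>.const_mul _) ?_
      (fun c => gav_abs_le _ _ _ (hs1 k)) ?_]
    · rw [integral_const_mul, integral_sub (integrable_const _)]
      · simp
      · exact Integrable.of_bound ((hgm k).pow_const 2).aestronglyMeasurable 1 (ae_of_all _ hsq)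
    · intro c x
      have hE : ∀ σ, HasDerivAt
          (fun y => gH (fun k => a k t) s b (Function.update c k y) σ) (a k t * s k σ) x := by
        intro σ
        unfold gH
        have h0 : ∀ j, HasDerivAt (fun y => a j t * Function.update c k y j * s j σ)
            (if j = k then a k t * s k σ else 0) x := by
          intro j
          by_cases h : j = k
          · subst h
            simpa using ((hasDerivAt_id x).const_mul (a j t)).mul_const (s j σ)
          · simpa [h] using hasDerivAt_const x (a j t * c j * s j σ)
        have h1 := (HasDerivAt.fun_sum (u := Finset.univ) fun j _ => h0 j).add_const (b σ)
        simpa using h1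
      have h2 := gav_hasDerivAt _ _ (s k) x hE
      convert! h2 using 1
      have e : (fun σ => s k σ * (a k t * s k σ)) = fun _ => a k t := by
        funext σ
        linear_combination a k t * hs k σ
      rw [e, gav_const, gav_mul_left]
      ring
    · intro c
      rw [abs_mul]
      refine mul_le_mul_of_nonneg_left ?_ (abs_nonneg _)
      refine (abs_sub _ _).trans ?_
      have := hsq c
      rw [abs_one]; linarith
  · refine Integrable.mono' (g := fun c : ι → ℝ => Real.log (Fintype.card S) +
      (∑ k, |a k t| * |c k| + ∑ σ, |b σ|)) ?_ (hlog t).aestronglyMeasurable (ae_of_all _ fun c => ?_)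
    · exact (integrable_const _).add ((integrable_finsetSum _ fun k _ =>
        ((gaussians_eval k).abs.const_mul _)).add (integrable_const _))
    · refine log_abs_le _ _ fun σ => ?_
      unfold gH
      refine (abs_add_le _ _).trans (add_le_add ?_ ?_)
      · refine (Finset.abs_sum_le_sum_abs _ _).trans (Finset.sum_le_sum fun k _ => ?_)
        rw [abs_mul, abs_mul]
        exact mul_le_of_le_one_right (by positivity) (hs1 k σ)
      · exact Finset.single_le_sum (f := fun σ => |b σ|) (fun _ _ => abs_nonneg _)
          (Finset.mem_univ σ)
  · have : F' t = fun c => ∑ k, a' k t * (c k * gav (gH (fun k => a k t) s b c) (s k)) :=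
      funext (hF'eq t)
    rw [this]
    exact (Finset.measurable_fun_sum _ fun k _ =>
      ((measurable_pi_apply k).mul (hgm k)).const_mul _).aestronglyMeasurable
  · refine ae_of_all _ fun c u hu => ?_
    rw [hF'eq, Real.norm_eq_abs]
    refine (Finset.abs_sum_le_sum_abs _ _).trans (Finset.sum_le_sum fun k _ => ?_)
    rw [abs_mul, abs_mul]
    refine mul_le_mul (hu k).2.le ?_ (by positivity) (by positivity)
    exact mul_le_of_le_one_right (abs_nonneg _) (gav_abs_le _ _ _ (hs1 k))
  · exact integrable_finsetSum _ fun k _ => (gaussians_eval k).abs.const_mul _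
  · refine ae_of_all _ fun c u hu => ?_
    refine log_hasDerivAt (fun u => gH (fun k => a k u) s b c) _ u fun σ => ?_
    unfold gH
    exact (HasDerivAt.fun_sum fun k _ =>
      (((hu k).1.mul_const (c k)).mul_const (s k σ))).add_const (b σ)

end gibbsGeneral

lemma sum_diag {A B : Type*} [Fintype A] [Fintype B] [DecidableEq A]
    (f : (A × B) × (A × B) → ℝ) :
    ∑ pq : (A × B) × (A × B), (if pq.1.1 = pq.2.1 then f pq else 0) =
      ∑ n : A, ∑ r : B, ∑ s : B, f ((n, r), (n, s)) := by
  simp only [Fintype.sum_prod_type]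
  refine Finset.sum_congr rfl fun n _ => Finset.sum_congr rfl fun r _ => ?_
  rw [Finset.sum_comm]
  simp

/-- For `t ∈ (0,1)`, Gaussian integration by parts gives the exact identity
`d/dt (1/|Λ|) E[ln Z_Λ(t)]
  = (β²/(4|Λ|)) E[ Σ_n (1/M) Σ_{i,j∈Ω_n} ⟨σ_iσ_j⟩_t² − Σ_{i,j∈Λ} (w(i−j;γ)/W(γ)) ⟨σ_iσ_j⟩_t² ]
    + (β²/4) ( (1/|Λ|) Σ_{i,j∈Λ} w(i−j;γ)/W(γ) − 1 )`,
where `|Λ| = (K·ℓ)^d`, `M = ℓ^d` and `⟨·⟩_t` is the Gibbs average of the interpolating model. -/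
theorem interpolation_derivative_identity
    (d K ℓ : ℕ) (hd : 1 ≤ d) (hK : 1 ≤ K) (hℓ : 1 ≤ ℓ)
    (φ : (Fin d → ℝ) → ℝ) (hφnonneg : ∀ r, 0 ≤ φ r)
    (hφsum : ∀ γ' : ℝ, 0 < γ' →
      Summable fun i : Fin d → ℤ => φ fun α => γ' * (i α : ℝ))
    (γ β h : ℝ) (hγ : 0 < γ) (hβ : 0 < β) :
    ∀ t ∈ Set.Ioo (0 : ℝ) 1,
      HasDerivAt (fun s => (1 / ((K * ℓ : ℕ) ^ d : ℝ)) * interpQuenched d K ℓ φ γ β h s)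
        (β ^ 2 / (4 * ((K * ℓ : ℕ) ^ d : ℝ)) *
          ∫ c : (Site d K ℓ × Site d K ℓ) ⊕ (Site d K ℓ × Site d K ℓ) → ℝ,
            (∑ n : Fin d → Fin K, (1 / (ℓ ^ d : ℝ)) *
                ∑ r : Fin d → Fin ℓ, ∑ s : Fin d → Fin ℓ,
                  (gibbs d K ℓ φ γ β h t (fun pq => c (Sum.inl pq)) (fun pq => c (Sum.inr pq))
                    (fun σ => spinVal (σ (n, r)) * spinVal (σ (n, s)))) ^ 2
              - ∑ p : Site d K ℓ, ∑ q : Site d K ℓ,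
                  (kacw d φ γ (fun α => sitePos p α - sitePos q α) / kacW d φ γ) *
                  (gibbs d K ℓ φ γ β h t (fun pq => c (Sum.inl pq)) (fun pq => c (Sum.inr pq))
                    (fun σ => spinVal (σ p) * spinVal (σ q))) ^ 2)
            ∂ gaussians ((Site d K ℓ × Site d K ℓ) ⊕ (Site d K ℓ × Site d K ℓ))
         + β ^ 2 / 4 *
            ((1 / ((K * ℓ : ℕ) ^ d : ℝ)) * ∑ p : Site d K ℓ, ∑ q : Site d K ℓ,
              kacw d φ γ (fun α => sitePos p α - sitePos q α) / kacW d φ γ - 1))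
        t := by
  intro t ht
  obtain ⟨ht0, ht1⟩ := ht
  set M : ℝ := (ℓ : ℝ) ^ d with hM
  have hMpos : 0 < M := by
    have : (0 : ℝ) < ℓ := by exact_mod_cast hℓ
    positivity
  set wq : Site d K ℓ → Site d K ℓ → ℝ := fun p q =>
    kacw d φ γ (fun α => sitePos p α - sitePos q α) / kacW d φ γ with hwq
  have hw0 : ∀ r, 0 ≤ kacw d φ γ r := fun r => mul_nonneg (by positivity) (hφnonneg _)
  have hW0 : 0 ≤ kacW d φ γ := tsum_nonneg hw0
  have hwq0 : ∀ p q, 0 ≤ wq p q := fun p q => div_nonneg (hw0 _) hW0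
  set ι := (Site d K ℓ × Site d K ℓ) ⊕ (Site d K ℓ × Site d K ℓ) with hι
  set κ : Site d K ℓ × Site d K ℓ → ℝ := fun pq =>
    if pq.1.1 = pq.2.1 then β / Real.sqrt (2 * M) else 0 with hκ
  set κ' : Site d K ℓ × Site d K ℓ → ℝ := fun pq =>
    β * Real.sqrt (kacw d φ γ (fun α => sitePos pq.1 α - sitePos pq.2 α) / (2 * kacW d φ γ))
    with hκ'
  set a : ι → ℝ → ℝ := fun k u => Sum.elim (fun pq => κ pq * Real.sqrt (1 - u))
    (fun pq => κ' pq * Real.sqrt u) k with ha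
  set a' : ι → ℝ → ℝ := fun k u => Sum.elim (fun pq => κ pq * (-(1 / (2 * Real.sqrt (1 - u)))))
    (fun pq => κ' pq * (1 / (2 * Real.sqrt u))) k with ha'
  set sp : Site d K ℓ × Site d K ℓ → (Site d K ℓ → Bool) → ℝ := fun pq σ =>
    spinVal (σ pq.1) * spinVal (σ pq.2) with hsp
  set s : ι → (Site d K ℓ → Bool) → ℝ := fun k σ => Sum.elim (fun pq => sp pq σ)
    (fun pq => sp pq σ) k with hs
  set b : (Site d K ℓ → Bool) → ℝ := fun σ => β * h * ∑ p : Site d K ℓ, spinVal (σ p) with hb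
  have hspin : ∀ x, spinVal x ^ 2 = 1 := by intro x; cases x <;> simp [spinVal]
  have hweight : ∀ u (c : ι → ℝ) σ, interpWeight d K ℓ φ γ β h u (fun pq => c (Sum.inl pq))
      (fun pq => c (Sum.inr pq)) σ = Real.exp (gH (fun k => a k u) s b c σ) := by
    intro u c σ
    unfold interpWeight gH
    congr 1
    rw [Fintype.sum_sum_type]
    simp only [ha, hs, hb, Sum.elim_inl, Sum.elim_inr]
    congr 2
    · have e : ∀ pq : Site d K ℓ × Site d K ℓ,
          κ pq * Real.sqrt (1 - u) * c (Sum.inl pq) * sp pq σ =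
          if pq.1.1 = pq.2.1 then β / Real.sqrt (2 * M) * Real.sqrt (1 - u) * c (Sum.inl pq) *
            sp pq σ else 0 := by
        intro pq
        simp only [hκ]
        split_ifs <;> ring
      rw [Finset.sum_congr rfl fun pq _ => e pq, sum_diag]
      simp only [Finset.mul_sum]
      refine Finset.sum_congr rfl fun n _ => ?_
      refine Finset.sum_congr rfl fun r _ => ?_
      refine Finset.sum_congr rfl fun r' _ => ?_
      simp only [hsp]
      ring
    · rw [Fintype.sum_prod_type (fun pq : Site d K ℓ × Site d K ℓ =>
        κ' pq * Real.sqrt u * c (Sum.inr pq) * sp pq σ)]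
      simp only [Finset.mul_sum]
      refine Finset.sum_congr rfl fun p _ => ?_
      refine Finset.sum_congr rfl fun q _ => ?_
      simp only [hsp, hκ']
      ring
  have hgibbs : ∀ (c : ι → ℝ) f, gibbs d K ℓ φ γ β h t (fun pq => c (Sum.inl pq))
      (fun pq => c (Sum.inr pq)) f = gav (gH (fun k => a k t) s b c) f := by
    intro c f
    unfold gibbs interpZ gav
    simp only [hweight]
  have hquen : ∀ u, interpQuenched d K ℓ φ γ β h u =
      ∫ c, Real.log (∑ σ, Real.exp (gH (fun k => a k u) s b c σ)) ∂(gaussians ι) := by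
    intro u
    unfold interpQuenched interpZ
    simp only [hweight]
    rfl
  have gen := general_deriv a a' s ?_ b t ?_ ?_
  rotate_left
  · rintro (pq | pq) σ <;> simp [hs, hsp, mul_pow, hspin]
  · have hev : ∀ᶠ u in nhds t, 0 < u ∧ u < 1 :=
      (lt_mem_nhds ht0).and (gt_mem_nhds ht1)
    rintro (pq | pq)
    · filter_upwards [hev] with u hu
      have h1 : HasDerivAt (fun u : ℝ => 1 - u) (-1) u := by
        simpa using (hasDerivAt_id u).const_sub 1
      have h2 := (h1.sqrt (by linarith [hu.2])).const_mul (κ pq)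
      simp only [ha, ha', Sum.elim_inl]
      convert! h2 using 1
      ring
    · filter_upwards [hev] with u hu
      exact (Real.hasDerivAt_sqrt hu.1.ne').const_mul (κ' pq)
  · have n0 : Real.sqrt t ≠ 0 := (Real.sqrt_pos.2 ht0).ne'
    have n1 : Real.sqrt (1 - t) ≠ 0 := (Real.sqrt_pos.2 (by linarith)).ne'
    rintro (pq | pq)
    · simp only [ha', Sum.elim_inl]
      refine ContinuousAt.mul continuousAt_const (ContinuousAt.neg
        (ContinuousAt.div continuousAt_const ?_ (by simpa using n1)))
      fun_prop
    · simp only [ha', Sum.elim_inr]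
      refine ContinuousAt.mul continuousAt_const
        (ContinuousAt.div continuousAt_const ?_ (by simpa using n0))
      fun_prop
  simp only [hquen, hgibbs]
  refine (gen.const_mul (1 / (((K * ℓ : ℕ) : ℝ) ^ d))).congr_deriv ?_
  set g : Site d K ℓ × Site d K ℓ → (ι → ℝ) → ℝ := fun pq c =>
    gav (gH (fun k => a k t) s b c) (sp pq) ^ 2 with hg
  have hgi : ∀ pq, Integrable (g pq) (gaussians ι) := by
    intro pq
    refine Integrable.of_bound (C := 1)
      ((gav_measurable _ s b _).pow_const 2).aestronglyMeasurable (ae_of_all _ fun c => ?_)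
    rw [Real.norm_eq_abs, abs_pow]
    refine pow_le_one₀ (abs_nonneg _) (gav_abs_le _ _ _ fun σ => ?_)
    rw [← sq_le_one_iff_abs_le_one]
    simp [hsp, mul_pow, hspin]
  have hint : (∫ c : ι → ℝ, (∑ n : Fin d → Fin K, (1 / M) *
        ∑ r : Fin d → Fin ℓ, ∑ r' : Fin d → Fin ℓ, g ((n, r), (n, r')) c
      - ∑ p : Site d K ℓ, ∑ q : Site d K ℓ, wq p q * g (p, q) c) ∂(gaussians ι)) =
      ∑ n : Fin d → Fin K, (1 / M) *
        ∑ r : Fin d → Fin ℓ, ∑ r' : Fin d → Fin ℓ, ∫ c, g ((n, r), (n, r')) c ∂(gaussians ι)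
      - ∑ p : Site d K ℓ, ∑ q : Site d K ℓ, wq p q * ∫ c, g (p, q) c ∂(gaussians ι) := by
    have j1 : ∀ n r, Integrable (fun c => ∑ r' : Fin d → Fin ℓ, g ((n, r), (n, r')) c)
        (gaussians ι) := fun n r => integrable_finsetSum _ fun r' _ => hgi _
    have j2 : ∀ n, Integrable (fun c => (1 / M) * ∑ r : Fin d → Fin ℓ, ∑ r' : Fin d → Fin ℓ,
        g ((n, r), (n, r')) c) (gaussians ι) := fun n =>
      (integrable_finsetSum _ fun r _ => j1 n r).const_mul _
    have j3 : ∀ p, Integrable (fun c => ∑ q : Site d K ℓ, wq p q * g (p, q) c)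
        (gaussians ι) := fun p => integrable_finsetSum _ fun q _ => (hgi _).const_mul _
    rw [integral_sub (integrable_finsetSum _ fun n _ => j2 n)
      (integrable_finsetSum _ fun p _ => j3 p),
      integral_finsetSum _ fun n _ => j2 n, integral_finsetSum _ fun p _ => j3 p]
    congr 1
    · refine Finset.sum_congr rfl fun n _ => ?_
      rw [integral_const_mul, integral_finsetSum _ fun r _ => j1 n r]
      congr 1
      refine Finset.sum_congr rfl fun r _ => ?_
      rw [integral_finsetSum _ fun r' _ => hgi _]
    · refine Finset.sum_congr rfl fun p _ => ?_
      rw [integral_finsetSum _ fun q _ => (hgi _).const_mul _]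
      refine Finset.sum_congr rfl fun q _ => ?_
      rw [integral_const_mul]
  refine Eq.trans ?_ (congrArg (fun x => β ^ 2 / (4 * ((K * ℓ : ℕ) : ℝ) ^ d) * x + β ^ 2 / 4 *
            ((1 / ((K * ℓ : ℕ) : ℝ) ^ d) * ∑ p : Site d K ℓ, ∑ q : Site d K ℓ,
              wq p q - 1)) hint.symm)
  set I : Site d K ℓ × Site d K ℓ → ℝ := fun pq => ∫ c, g pq c ∂(gaussians ι) with hI
  have n0 : Real.sqrt t ≠ 0 := (Real.sqrt_pos.2 ht0).ne'
  have n1 : Real.sqrt (1 - t) ≠ 0 := (Real.sqrt_pos.2 (by linarith)).ne'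
  have hsum : (∑ k, a' k t * a k t *
      (1 - ∫ c, gav (gH (fun k => a k t) s b c) (s k) ^ 2 ∂(gaussians ι))) =
      (∑ n : Fin d → Fin K, ∑ r : Fin d → Fin ℓ, ∑ r' : Fin d → Fin ℓ,
        (-(β ^ 2 / (4 * M)) * (1 - I ((n, r), (n, r'))))) +
      ∑ p : Site d K ℓ, ∑ q : Site d K ℓ, β ^ 2 / 4 * wq p q * (1 - I (p, q)) := by
    rw [Fintype.sum_sum_type]
    congr 1
    · rw [← sum_diag (fun pq => -(β ^ 2 / (4 * M)) * (1 - I pq))]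
      refine Finset.sum_congr rfl fun pq _ => ?_
      have e1 : a' (Sum.inl pq) t * a (Sum.inl pq) t = -(κ pq ^ 2 / 2) := by
        simp only [ha, ha', Sum.elim_inl]
        field_simp
      have e2 : (∫ c, gav (gH (fun k => a k t) s b c) (s (Sum.inl pq)) ^ 2 ∂(gaussians ι)) =
        I pq := rfl
      rw [e1, e2]
      simp only [hκ]
      split_ifs
      · rw [div_pow, Real.sq_sqrt (by positivity)]
        field_simp
        ring
      · simp
    · rw [Fintype.sum_prod_type]
      refine Finset.sum_congr rfl fun p _ => ?_
      refine Finset.sum_congr rfl fun q _ => ?_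
      have e1 : a' (Sum.inr (p, q)) t * a (Sum.inr (p, q)) t = κ' (p, q) ^ 2 / 2 := by
        simp only [ha, ha', Sum.elim_inr]
        field_simp
      have e2 : (∫ c, gav (gH (fun k => a k t) s b c) (s (Sum.inr (p, q))) ^ 2 ∂(gaussians ι)) =
        I (p, q) := rfl
      have e3 : kacw d φ γ (fun α => sitePos p α - sitePos q α) / (2 * kacW d φ γ) =
          wq p q / 2 := by
        simp only [hwq]; rw [div_div, mul_comm]
      rw [e1, e2]
      simp only [hκ']
      rw [e3, mul_pow, Real.sq_sqrt (by linarith [hwq0 p q])]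
      ring
  rw [hsum]
  have hN : ((K * ℓ : ℕ) : ℝ) ^ d = (K : ℝ) ^ d * M := by
    push_cast; rw [mul_pow]
  have hKpos : (0 : ℝ) < (K : ℝ) ^ d := by
    have : (0 : ℝ) < K := by exact_mod_cast hK
    positivity
  rw [hN]
  simp only [mul_sub, mul_one, Finset.sum_sub_distrib, Finset.sum_const, Finset.card_univ,
    Fintype.card_fun, Fintype.card_fin, nsmul_eq_mul, ← Finset.mul_sum, mul_assoc, Nat.cast_pow]
  rw [← hM]
  field_simp
  ring
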